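/- arXiv:0711.0103 — 4 statements merged into one kernel-verified Lean document; each statement's English description precedes it below -/
import Mathlib

section
/- Let (f,τ) : (P_1,F_1) → (P_2,F_2) be a morphism of coloured posets over a commutative unital ring R. Then the gluing (P_1 ∪_f P_2, F) is a coloured poset: the relation defined on the disjoint union is a partial order with unique maximal element 1_{P_2}, and F is a well-defined covariant functor from P_1 ∪_f P_2 to Mod_R (in particular F_{a′}^{a″} ∘ F_a^{a′} = F_a^{a″} for all a ≤ a′ ≤ a″). -/
open DirectSum

noncomputable section

noncomputable instance (priority := 10) instDecEqOfClassical {α : Sort _} : DecidableEq α :=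
  fun a b => Classical.propDecidable _

/-- A coloured poset structure on `P`: a covariant functor `F : P → Mod_R`
(the poset `P` being viewed as a category with a unique morphism `x → y` whenever `x ≤ y`). -/
structure Colouring (R : Type) [CommRing R] (P : Type) [PartialOrder P] where
  M : P → Type
  [addCommGroup : ∀ x, AddCommGroup (M x)]
  [module : ∀ x, Module R (M x)]
  map : ∀ {x y : P}, x ≤ y → (M x →ₗ[R] M y)
  map_id : ∀ x : P, map (le_refl x) = LinearMap.id
  map_comp : ∀ {x y z : P} (h₁ : x ≤ y) (h₂ : y ≤ z),
      map (h₁.trans h₂) = (map h₂).comp (map h₁)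

attribute [instance] Colouring.addCommGroup Colouring.module

/-- The constant colouring of `P` by a fixed `R`-module `A`. -/
def constColouring (R : Type) [CommRing R] (P : Type) [PartialOrder P]
    (A : Type) [AddCommGroup A] [Module R A] : Colouring R P where
  M _ := A
  map _ := LinearMap.id
  map_id _ := rfl
  map_comp _ _ := rfl

/-- A morphism of coloured posets `(f, τ) : (P₁, F₁) → (P₂, F₂)`. -/
structure ColouredHom {R : Type} [CommRing R] {P₁ P₂ : Type}
    [PartialOrder P₁] [OrderTop P₁] [PartialOrder P₂] [OrderTop P₂]
    (F₁ : Colouring R P₁) (F₂ : Colouring R P₂) where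
  toFun : P₁ → P₂
  mono : Monotone toFun
  top_iff : ∀ x : P₁, toFun x = ⊤ ↔ x = ⊤
  τ : ∀ x : P₁, F₁.M x →ₗ[R] F₂.M (toFun x)
  natural : ∀ {x y : P₁} (h : x ≤ y),
      (τ y).comp (F₁.map h) = (F₂.map (mono h)).comp (τ x)

section Sequences

variable {R : Type} [CommRing R] {P : Type} [PartialOrder P] [OrderTop P]

/-- Multi-sequences `x₁ ≤ x₂ ≤ ⋯ ≤ x_k` of length `k` in `P ∖ {1_P}`. -/
def MSeq (P : Type) [PartialOrder P] [OrderTop P] (k : ℕ) : Type :=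
  {s : Fin k → P // Monotone s ∧ ∀ i, s i ≠ ⊤}

/-- (Strictly increasing) sequences `x₁ < x₂ < ⋯ < x_k` of length `k` in `P ∖ {1_P}`. -/
def CSeq (P : Type) [PartialOrder P] [OrderTop P] (k : ℕ) : Type :=
  {s : Fin k → P // StrictMono s ∧ ∀ i, s i ≠ ⊤}

/-- The first element `x₁` of a sequence; by convention the head of the empty
sequence is `1_P`, so that the degree `0` part of the complexes below is `F(1_P)`. -/
def seqHead {P : Type} [PartialOrder P] [OrderTop P] {k : ℕ} (s : Fin k → P) : P :=
  if h : 0 < k then s ⟨0, h⟩ else ⊤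

/-- Deleting the `j`-th entry of a multi-sequence. -/
def MSeq.remove {k : ℕ} (s : MSeq P (k+1)) (j : Fin (k+1)) : MSeq P k :=
  ⟨fun i => s.1 (j.succAbove i),
    s.2.1.comp (Fin.strictMono_succAbove j).monotone, fun i => s.2.2 _⟩

/-- Deleting the `j`-th entry of a sequence. -/
def CSeq.remove {k : ℕ} (s : CSeq P (k+1)) (j : Fin (k+1)) : CSeq P k :=
  ⟨fun i => s.1 (j.succAbove i),
    s.2.1.comp (Fin.strictMono_succAbove j), fun i => s.2.2 _⟩

lemma seqHead_le_msRemove {k : ℕ} (s : MSeq P (k+1)) (j : Fin (k+1)) :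
    seqHead s.1 ≤ seqHead (s.remove j).1 := by
  have h0 : seqHead s.1 = s.1 ⟨0, Nat.succ_pos k⟩ := dif_pos _
  rw [h0]
  unfold seqHead MSeq.remove
  split
  · exact s.2.1 (Fin.zero_le _)
  · exact le_top

lemma seqHead_le_csRemove {k : ℕ} (s : CSeq P (k+1)) (j : Fin (k+1)) :
    seqHead s.1 ≤ seqHead (s.remove j).1 := by
  have h0 : seqHead s.1 = s.1 ⟨0, Nat.succ_pos k⟩ := dif_pos _
  rw [h0]
  unfold seqHead CSeq.remove
  split
  · exact (s.2.1.monotone) (Fin.zero_le _)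
  · exact le_top

variable (F : Colouring R P)

/-- The chain module `S_k(P, F)`: one direct summand `F(x₁)` for each length `k`
multi-sequence `x₁ ≤ ⋯ ≤ x_k` in `P ∖ {1_P}` (and `S₀ = F(1_P)`). -/
abbrev SMod (k : ℕ) : Type := ⨁ s : MSeq P k, F.M (seqHead s.1)

/-- The chain module `C_k(P, F)`: one direct summand `F(x₁)` for each length `k`
sequence `x₁ < ⋯ < x_k` in `P ∖ {1_P}` (and `C₀ = F(1_P)`). -/
abbrev CMod (k : ℕ) : Type := ⨁ s : CSeq P k, F.M (seqHead s.1)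

/-- The differential of `S_*(P,F)`:
`d(λ x₁x₂⋯x_k) = F_{x₁}^{x₂}(λ) x₂⋯x_k − Σ_{i=2}^{k} (−1)^i λ x₁⋯x̂ᵢ⋯x_k`,
with `d(λ x) = F_x^{1_P}(λ)` in degree 1. -/
def sDiff (k : ℕ) : SMod F (k+1) →ₗ[R] SMod F k :=
  DirectSum.toModule R _ _ fun s =>
    ∑ j : Fin (k+1), ((-1 : R) ^ (j : ℕ)) •
      ((DirectSum.lof R (MSeq P k) (fun t => F.M (seqHead t.1)) (s.remove j)).comp
        (F.map (seqHead_le_msRemove s j)))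

/-- The differential of `C_*(P,F)` (the restriction of that of `S_*(P,F)`). -/
def cDiff (k : ℕ) : CMod F (k+1) →ₗ[R] CMod F k :=
  DirectSum.toModule R _ _ fun s =>
    ∑ j : Fin (k+1), ((-1 : R) ^ (j : ℕ)) •
      ((DirectSum.lof R (CSeq P k) (fun t => F.M (seqHead t.1)) (s.remove j)).comp
        (F.map (seqHead_le_csRemove s j)))

end Sequences

section Homology

variable {R : Type} [CommRing R]

/-- The cycles of an `ℕ`-indexed chain complex given by `d n : X (n+1) → X n`. -/
def hCycles {X : ℕ → Type} [∀ n, AddCommGroup (X n)] [∀ n, Module R (X n)]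
    (d : ∀ n, X (n+1) →ₗ[R] X n) : ∀ n, Submodule R (X n)
  | 0 => ⊤
  | (n+1) => LinearMap.ker (d n)

/-- The homology `ker d / im d` in degree `n` of an `ℕ`-indexed chain complex. -/
def hHomology {X : ℕ → Type} [∀ n, AddCommGroup (X n)] [∀ n, Module R (X n)]
    (d : ∀ n, X (n+1) →ₗ[R] X n) (n : ℕ) : Type :=
  hCycles d n ⧸ Submodule.comap (hCycles d n).subtype (LinearMap.range (d n))

instance {X : ℕ → Type} [∀ n, AddCommGroup (X n)] [∀ n, Module R (X n)]
    (d : ∀ n, X (n+1) →ₗ[R] X n) (n : ℕ) : AddCommGroup (hHomology d n) := by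
  unfold hHomology; infer_instance

instance {X : ℕ → Type} [∀ n, AddCommGroup (X n)] [∀ n, Module R (X n)]
    (d : ∀ n, X (n+1) →ₗ[R] X n) (n : ℕ) : Module R (hHomology d n) := by
  unfold hHomology; infer_instance

/-- The class in homology of a cycle. -/
def hClass {X : ℕ → Type} [∀ n, AddCommGroup (X n)] [∀ n, Module R (X n)]
    (d : ∀ n, X (n+1) →ₗ[R] X n) (n : ℕ) (z : X n) (hz : z ∈ hCycles d n) :
    hHomology d n :=
  Submodule.Quotient.mk ⟨z, hz⟩

/-- The map induced in homology by a (degree-preserving) chain map. -/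
def inducedHom {X Y : ℕ → Type}
    [∀ n, AddCommGroup (X n)] [∀ n, Module R (X n)]
    [∀ n, AddCommGroup (Y n)] [∀ n, Module R (Y n)]
    (dX : ∀ n, X (n+1) →ₗ[R] X n) (dY : ∀ n, Y (n+1) →ₗ[R] Y n)
    (g : ∀ n, X n →ₗ[R] Y n)
    (hg : ∀ n, (dY n).comp (g (n+1)) = (g n).comp (dX n)) (n : ℕ) :
    hHomology dX n →ₗ[R] hHomology dY n := by
  refine Submodule.mapQ _ _
    ((g n).restrict (p := hCycles dX n) (q := hCycles dY n) ?_) ?_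
  · intro x hx
    match n with
    | 0 => exact Submodule.mem_top
    | (n+1) =>
      have h' := LinearMap.congr_fun (hg n) x
      simp only [LinearMap.comp_apply] at h'
      simp only [hCycles, LinearMap.mem_ker] at hx ⊢
      rw [h', hx, map_zero]
  · intro x hx
    simp only [Submodule.mem_comap, LinearMap.mem_range] at hx ⊢
    obtain ⟨y, hy⟩ := hx
    refine ⟨g (n+1) y, ?_⟩
    have h' := LinearMap.congr_fun (hg n) y
    simp only [LinearMap.comp_apply] at h'
    show dY n (g (n+1) y) = g n x.1
    rw [h']
    exact congrArg (g n) hy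

/-- The map induced in homology by a degree `−1` chain map. -/
def inducedHomShift {X Y : ℕ → Type}
    [∀ n, AddCommGroup (X n)] [∀ n, Module R (X n)]
    [∀ n, AddCommGroup (Y n)] [∀ n, Module R (Y n)]
    (dX : ∀ n, X (n+1) →ₗ[R] X n) (dY : ∀ n, Y (n+1) →ₗ[R] Y n)
    (g : ∀ n, X (n+1) →ₗ[R] Y n)
    (hg : ∀ n, (dY n).comp (g (n+1)) = (g n).comp (dX (n+1))) (n : ℕ) :
    hHomology dX (n+1) →ₗ[R] hHomology dY n := by
  have hcyc : ∀ x ∈ hCycles dX (n+1), g n x ∈ hCycles dY n := by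
    intro x hx
    match n with
    | 0 => exact Submodule.mem_top
    | (n+1) =>
      have h' := LinearMap.congr_fun (hg n) x
      simp only [LinearMap.comp_apply] at h'
      simp only [hCycles, LinearMap.mem_ker] at hx ⊢
      rw [h', hx, map_zero]
  refine Submodule.mapQ
      (Submodule.comap (hCycles dX (n+1)).subtype (LinearMap.range (dX (n+1))))
      (Submodule.comap (hCycles dY n).subtype (LinearMap.range (dY n)))
      ((g n).restrict hcyc) ?_
  intro x hx
  simp only [Submodule.mem_comap, LinearMap.mem_range] at hx ⊢
  obtain ⟨y, hy⟩ := hx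
  refine ⟨g (n+1) y, ?_⟩
  have h' := LinearMap.congr_fun (hg n) y
  simp only [LinearMap.comp_apply] at h'
  show dY n (g (n+1) y) = g n x.1
  rw [h']
  exact congrArg (g n) hy

end Homology

section Glued

variable {R : Type} [CommRing R] {P₁ P₂ : Type} [PartialOrder P₁] [OrderTop P₁]
  [PartialOrder P₂] [OrderTop P₂] {F₁ : Colouring R P₁} {F₂ : Colouring R P₂}

/-- The relation on the underlying set `P₁ ⊔ P₂` of the gluing `P₁ ∪_f P₂`:
within each `Pᵢ` the original order, and `a ≤ a'` for `a ∈ P₁`, `a' ∈ P₂` iff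
`f(a) ≤ a'` in `P₂`. -/
def GluedLE (f : P₁ → P₂) : P₁ ⊕ P₂ → P₁ ⊕ P₂ → Prop
  | Sum.inl a, Sum.inl b => a ≤ b
  | Sum.inl a, Sum.inr b => f a ≤ b
  | Sum.inr _, Sum.inl _ => False
  | Sum.inr a, Sum.inr b => a ≤ b

/-- The modules colouring the gluing: `F(a) = Fᵢ(a)` for `a ∈ Pᵢ`. -/
def gluedM (F₁ : Colouring R P₁) (F₂ : Colouring R P₂) : P₁ ⊕ P₂ → Type :=
  Sum.elim F₁.M F₂.M

instance (a : P₁ ⊕ P₂) : AddCommGroup (gluedM F₁ F₂ a) := by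
  cases a with
  | inl x => exact inferInstanceAs (AddCommGroup (F₁.M x))
  | inr y => exact inferInstanceAs (AddCommGroup (F₂.M y))

instance (a : P₁ ⊕ P₂) : Module R (gluedM F₁ F₂ a) := by
  cases a with
  | inl x => exact inferInstanceAs (Module R (F₁.M x))
  | inr y => exact inferInstanceAs (Module R (F₂.M y))

/-- The structure maps colouring the gluing: `F_a^{a'} = (Fᵢ)_a^{a'}` within `Pᵢ`, and
`F_a^{a'} = (F₂)_{f(a)}^{a'} ∘ τ_a` for `a ∈ P₁ ≤ a' ∈ P₂`. -/
def gluedMap (φ : ColouredHom F₁ F₂) :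
    ∀ {a b : P₁ ⊕ P₂}, GluedLE φ.toFun a b → (gluedM F₁ F₂ a →ₗ[R] gluedM F₁ F₂ b)
  | Sum.inl _, Sum.inl _, h => F₁.map h
  | Sum.inl x, Sum.inr _, h => (F₂.map h).comp (φ.τ x)
  | Sum.inr _, Sum.inl _, h => False.elim h
  | Sum.inr _, Sum.inr _, h => F₂.map h

end Glued

/-- Let `(f,τ) : (P₁,F₁) → (P₂,F₂)` be a morphism of coloured posets over
a commutative unital ring `R`. Then the gluing `(P₁ ∪_f P₂, F)` is a coloured poset: the
relation on the disjoint union is a partial order whose unique maximal element is `1_{P₂}`,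
and `F` is a well-defined covariant functor to `Mod_R` (in particular
`F_{a'}^{a''} ∘ F_a^{a'} = F_a^{a''}` for all `a ≤ a' ≤ a''`, and `F_a^a = id`). -/
theorem glued_isColouredPoset {R : Type} [CommRing R] {P₁ P₂ : Type}
    [PartialOrder P₁] [OrderTop P₁] [PartialOrder P₂] [OrderTop P₂]
    {F₁ : Colouring R P₁} {F₂ : Colouring R P₂} (φ : ColouredHom F₁ F₂) :
    IsPartialOrder (P₁ ⊕ P₂) (GluedLE φ.toFun) ∧
    (∀ a : P₁ ⊕ P₂, GluedLE φ.toFun a (Sum.inr ⊤)) ∧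
    (∀ a : P₁ ⊕ P₂, (∀ b, GluedLE φ.toFun a b → b = a) → a = Sum.inr ⊤) ∧
    (∀ (a : P₁ ⊕ P₂) (h : GluedLE φ.toFun a a), gluedMap φ h = LinearMap.id) ∧
    (∀ (a b c : P₁ ⊕ P₂) (hab : GluedLE φ.toFun a b) (hbc : GluedLE φ.toFun b c)
        (hac : GluedLE φ.toFun a c),
        gluedMap φ hac = (gluedMap φ hbc).comp (gluedMap φ hab)) := by
  refine ⟨{ refl := ?_, trans := ?_, antisymm := ?_ }, ?_, ?_, ?_, ?_⟩
  · rintro (a | a)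
    · exact le_refl a
    · exact le_refl a
  · rintro (a | a) (b | b) (c | c) hab hbc
    · exact le_trans (α := P₁) hab hbc
    · exact le_trans (φ.mono hab) hbc
    · exact hbc.elim
    · exact le_trans (α := P₂) hab hbc
    · exact hab.elim
    · exact hab.elim
    · exact hbc.elim
    · exact le_trans (α := P₂) hab hbc
  · rintro (a | a) (b | b) hab hba
    · exact congrArg Sum.inl (le_antisymm hab hba)
    · exact hba.elim
    · exact hab.elim
    · exact congrArg Sum.inr (le_antisymm hab hba)
  · rintro (a | a)
    · exact le_top (α := P₂)
    · exact le_top (α := P₂)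
  · rintro (a | a) h
    · exact (h (Sum.inr ⊤) (le_top (α := P₂))).symm
    · exact (h (Sum.inr ⊤) (le_top (α := P₂))).symm
  · rintro (a | a) h
    · exact F₁.map_id a
    · exact F₂.map_id a
  · rintro (a | a) (b | b) (c | c) hab hbc hac
    · exact F₁.map_comp hab hbc
    · change (F₂.map hac).comp (φ.τ a) =
        ((F₂.map hbc).comp (φ.τ b)).comp (F₁.map hab)
      rw [LinearMap.comp_assoc, φ.natural hab, ← LinearMap.comp_assoc,
        ← F₂.map_comp (φ.mono hab) hbc]
    · exact hbc.elim
    · change (F₂.map hac).comp (φ.τ a) =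
        (F₂.map hbc).comp ((F₂.map hab).comp (φ.τ a))
      rw [← LinearMap.comp_assoc, ← F₂.map_comp hab hbc]
    · exact hab.elim
    · exact hab.elim
    · exact hbc.elim
    · exact F₂.map_comp hab hbc
end
end

section
/- For any coloured poset (P,F) over a commutative unital ring R, the graded module S_*(P,F) with the differential d defined below satisfies d_{k-1} ∘ d_k = 0 for all k, i.e. (S_*(P,F), d) is a chain complex of R-modules. -/
open DirectSum

noncomputable section

theorem MSeq.remove_remove {P : Type} [PartialOrder P] [OrderTop P] {k : ℕ} (s : MSeq P (k+2))
    (i : Fin (k+2)) (j : Fin (k+1)) :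
    (s.remove (i.succAbove j)).remove (j.predAbove i) = (s.remove i).remove j :=
  Subtype.ext <| funext fun n =>
    congrArg s.1 (Fin.succAbove_succAbove_succAbove_predAbove i j n)

theorem lof_comp_map_congr {R : Type} [CommRing R] {P : Type} [PartialOrder P] [OrderTop P]
    (F : Colouring R P) {k : ℕ} {x : P} {t t' : MSeq P k} (h : t = t')
    (ht : x ≤ seqHead t.1) (ht' : x ≤ seqHead t'.1) :
    (DirectSum.lof R (MSeq P k) (fun t => F.M (seqHead t.1)) t).comp (F.map ht) =
      (DirectSum.lof R (MSeq P k) (fun t => F.M (seqHead t.1)) t').comp (F.map ht') := by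
  subst h
  rfl

theorem sDiff_comp_lof {R : Type} [CommRing R] {P : Type} [PartialOrder P] [OrderTop P]
    (F : Colouring R P) (k : ℕ) (s : MSeq P (k+1)) :
    (sDiff F k).comp (DirectSum.lof R (MSeq P (k+1)) (fun t => F.M (seqHead t.1)) s) =
      ∑ j : Fin (k+1), ((-1 : R) ^ (j : ℕ)) •
        ((DirectSum.lof R (MSeq P k) (fun t => F.M (seqHead t.1)) (s.remove j)).comp
          (F.map (seqHead_le_msRemove s j))) := by
  refine LinearMap.ext fun x => ?_
  rw [LinearMap.comp_apply, sDiff]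
  exact DirectSum.toModule_lof (M := fun t : MSeq P (k+1) => F.M (seqHead t.1)) R s x

theorem sDiff_comp_sDiff_comp_lof {R : Type} [CommRing R] {P : Type} [PartialOrder P]
    [OrderTop P] (F : Colouring R P) (k : ℕ) (s : MSeq P (k+2)) :
    ((sDiff F k).comp (sDiff F (k+1))).comp
        (DirectSum.lof R (MSeq P (k+2)) (fun t => F.M (seqHead t.1)) s) =
      ∑ p : Fin (k+2) × Fin (k+1), ((-1 : R) ^ (p.1 + p.2 : ℕ)) •
        ((DirectSum.lof R (MSeq P k) (fun t => F.M (seqHead t.1))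
          ((s.remove p.1).remove p.2)).comp
          (F.map ((seqHead_le_msRemove s p.1).trans
            (seqHead_le_msRemove (s.remove p.1) p.2)))) := by
  rw [LinearMap.comp_assoc, sDiff_comp_lof, Fintype.sum_prod_type]
  refine (map_sum (LinearMap.compRight R (sDiff F k)) _ _).trans
    (Finset.sum_congr rfl fun i _ => ?_)
  rw [LinearMap.compRight_apply, LinearMap.comp_smul, ← LinearMap.comp_assoc, sDiff_comp_lof]
  refine (congrArg _ (map_sum (LinearMap.lcomp R (SMod F k)
    (F.map (seqHead_le_msRemove s i))) _ _)).trans (Finset.smul_sum.trans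
      (Finset.sum_congr rfl fun j _ => ?_))
  rw [LinearMap.lcomp_apply', LinearMap.smul_comp, smul_smul, ← pow_add, LinearMap.comp_assoc,
    ← F.map_comp]

/-- For any coloured poset `(P, F)` over a commutative unital ring `R`,
the graded module `S_*(P,F)` with the differential `d` satisfies `d ∘ d = 0`,
i.e. `(S_*(P,F), d)` is a chain complex of `R`-modules. -/
theorem sDiff_comp_sDiff {R : Type} [CommRing R] {P : Type} [PartialOrder P] [OrderTop P]
    (F : Colouring R P) :
    ∀ k : ℕ, (sDiff F k).comp (sDiff F (k+1)) = 0 := by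
  intro k
  refine DirectSum.linearMap_ext R fun s => ?_
  rw [sDiff_comp_sDiff_comp_lof, LinearMap.zero_comp]
  refine Finset.sum_involution (fun p _ => (p.1.succAbove p.2, p.2.predAbove p.1))
    ?_ ?_ (fun _ _ => Finset.mem_univ _) ?_
  · rintro ⟨i, j⟩ -
    dsimp only
    rw [lof_comp_map_congr F (s.remove_remove i j) _
      ((seqHead_le_msRemove s i).trans (seqHead_le_msRemove (s.remove i) j)),
      Fin.neg_one_pow_succAbove_add_predAbove]
    exact (congrArg (_ + ·) (neg_smul _ _)).trans (add_neg_cancel _)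
  · rintro ⟨i, j⟩ - - h
    exact Fin.succAbove_ne i j (congrArg Prod.fst h)
  · rintro ⟨i, j⟩ -
    exact Prod.ext (Fin.succAbove_succAbove_predAbove i j) (Fin.predAbove_predAbove_succAbove i j)
end
end

section
/- For any coloured poset (P,F), the inclusion C_*(P,F) → S_*(P,F) is a chain homotopy equivalence; in particular H_n(P,F) ≅ H_n(C_*(P,F)) for all n. -/
open DirectSum

noncomputable section

section HomotopyEquivalence

/-- `f` is a chain homotopy equivalence between the `ℕ`-indexed chain complexes
`(X, dX)` and `(Y, dY)`: there is a chain map `g` backwards and chain homotopies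
`id − g∘f = d∘H + H∘d` and `id − f∘g = d∘K + K∘d`. -/
def IsChainHomotopyEquivalence {R : Type} [CommRing R] {X Y : ℕ → Type}
    [∀ n, AddCommGroup (X n)] [∀ n, Module R (X n)]
    [∀ n, AddCommGroup (Y n)] [∀ n, Module R (Y n)]
    (dX : ∀ n, X (n+1) →ₗ[R] X n) (dY : ∀ n, Y (n+1) →ₗ[R] Y n)
    (f : ∀ n, X n →ₗ[R] Y n) : Prop :=
  ∃ (g : ∀ n, Y n →ₗ[R] X n)
    (H : ∀ n, X n →ₗ[R] X (n+1)) (K : ∀ n, Y n →ₗ[R] Y (n+1)),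
    (∀ n, (dX n).comp (g (n+1)) = (g n).comp (dY n)) ∧
    (∀ n, (g (n+1)).comp (f (n+1)) - LinearMap.id =
        (dX (n+1)).comp (H (n+1)) + (H n).comp (dX n)) ∧
    ((g 0).comp (f 0) - LinearMap.id = (dX 0).comp (H 0)) ∧
    (∀ n, (f (n+1)).comp (g (n+1)) - LinearMap.id =
        (dY (n+1)).comp (K (n+1)) + (K n).comp (dY n)) ∧
    ((f 0).comp (g 0) - LinearMap.id = (dY 0).comp (K 0))

end HomotopyEquivalence

section CInclusion

variable {R : Type} [CommRing R] {P : Type} [PartialOrder P] [OrderTop P]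

/-- The inclusion of complexes `C_*(P,F) → S_*(P,F)`. -/
def cIncl (F : Colouring R P) (k : ℕ) : CMod F k →ₗ[R] SMod F k :=
  DirectSum.toModule R _ _ fun s =>
    DirectSum.lof R (MSeq P k) (fun t => F.M (seqHead t.1))
      (⟨s.1, s.2.1.monotone, s.2.2⟩ : MSeq P k)

end CInclusion

/-- The sequence `s` is injective up to position `p`, and repeats there: `s p = s (p + 1)`. -/
def IsFirstRepeat {α : Type} {k : ℕ} (s : Fin k → α) (p : Fin k) : Prop :=
  (∃ h : (p : ℕ) + 1 < k, s p = s ⟨p + 1, h⟩) ∧ ∀ a b, a < b → b ≤ p → s a ≠ s b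

lemma IsFirstRepeat.unique {α : Type} {k : ℕ} {s : Fin k → α} {p q : Fin k}
    (hp : IsFirstRepeat s p) (hq : IsFirstRepeat s q) : p = q := by
  wlog hlt : p < q generalizing p q
  · rcases lt_trichotomy p q with h | h | h
    · exact absurd h hlt
    · exact h
    · exact (this hq hp h).symm
  obtain ⟨⟨h, e⟩, -⟩ := hp
  refine absurd e (hq.2 _ _ ?_ ?_)
  · simp [Fin.lt_def]
  · simpa [Fin.le_def, Nat.succ_le_iff] using hlt

lemma IsFirstRepeat.not_strictMono {α : Type} [Preorder α] {k : ℕ} {s : Fin k → α} {p : Fin k}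
    (hp : IsFirstRepeat s p) : ¬ StrictMono s := by
  obtain ⟨⟨h, e⟩, -⟩ := hp
  intro hs
  exact (hs (show p < ⟨p + 1, h⟩ by simp [Fin.lt_def])).ne e

lemma exists_isFirstRepeat {α : Type} [PartialOrder α] {k : ℕ} {s : Fin k → α} (hs : Monotone s)
    (hns : ¬ StrictMono s) : ∃ p, IsFirstRepeat s p := by
  classical
  have hex : ∃ n, ∃ a b : Fin k, (b : ℕ) = n ∧ a < b ∧ s a = s b := by
    by_contra hno
    push Not at hno
    exact hns fun a b hab => lt_of_le_of_ne (hs hab.le) (hno b a b rfl hab)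
  obtain ⟨a, b, hb, hab, e⟩ := Nat.find_spec hex
  have hab' : (a : ℕ) < b := hab
  refine ⟨⟨b - 1, by omega⟩, ⟨by simp only []; omega, ?_⟩, ?_⟩
  · have hb1 : (⟨(b : ℕ) - 1 + 1, by omega⟩ : Fin k) = b := by ext; simp only []; omega
    simp only [hb1]
    refine le_antisymm (hs ?_) (e ▸ hs ?_) <;> simp only [Fin.le_def] <;> omega
  · intro a' b' hab' hb' e'
    simp only [Fin.le_def] at hb'
    exact Nat.find_min hex (m := b') (by omega) ⟨a', b', rfl, hab', e'⟩

lemma sum_add_sum_eq_of_cancel {A : Type} [AddCommGroup A] {k : ℕ} (a : Fin (k + 2) → A)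
    (b : Fin (k + 1) → A) (x : A) (p : ℕ) (hp : p + 1 < k + 1)
    (hlt : ∀ j : Fin (k + 1), (j : ℕ) < p → a j.castSucc + b j = 0)
    (h₀ : a ⟨p, by omega⟩ = x) (h₁ : a ⟨p + 1, by omega⟩ = -x) (h₂ : a ⟨p + 2, by omega⟩ = x)
    (hb : b ⟨p, by omega⟩ + b ⟨p + 1, hp⟩ = 0)
    (hgt : ∀ j : Fin (k + 1), p + 2 ≤ (j : ℕ) → a j.succ + b j = 0) :
    ∑ j, a j + ∑ j, b j = x := by
  have key : ∑ j, (a ((⟨p + 2, by omega⟩ : Fin (k + 2)).succAbove j) + b j) = 0 := by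
    rw [Fintype.sum_eq_add (⟨p, by omega⟩ : Fin (k + 1)) ⟨p + 1, hp⟩ (by simp [Fin.ext_iff])]
    · rw [Fin.succAbove_of_castSucc_lt _ _ (by simp [Fin.lt_def]),
        Fin.succAbove_of_castSucc_lt _ _ (by simp [Fin.lt_def])]
      simp only [Fin.castSucc_mk, h₀, h₁]
      rw [add_add_add_comm, hb, add_neg_cancel, add_zero]
    · rintro j ⟨hj, hj'⟩
      simp only [ne_eq, Fin.ext_iff] at hj hj'
      rcases lt_or_ge (j : ℕ) p with h | h
      · rw [Fin.succAbove_of_castSucc_lt _ _ (by simp [Fin.lt_def]; omega)]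
        exact hlt j h
      · rw [Fin.succAbove_of_le_castSucc _ _ (by simp [Fin.le_def]; omega)]
        exact hgt j (by omega)
  rw [Finset.sum_add_distrib] at key
  rw [Fin.sum_univ_succAbove a ⟨p + 2, by omega⟩, h₂, add_assoc, key, add_zero]

lemma Colouring.map_map {R : Type} [CommRing R] {P : Type} [PartialOrder P] {F : Colouring R P}
    {x y z : P} (h₁ : x ≤ y) (h₂ : y ≤ z) (m : F.M x) :
    F.map h₂ (F.map h₁ m) = F.map (h₁.trans h₂) m := by
  rw [F.map_comp h₁ h₂, LinearMap.comp_apply]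

section Duplication

variable {P : Type} [PartialOrder P] [OrderTop P]

lemma MSeq.ext {k : ℕ} {s t : MSeq P k} (h : ∀ i, s.1 i = t.1 i) : s = t :=
  Subtype.ext (funext h)

lemma MSeq.remove_apply {k : ℕ} (s : MSeq P (k + 1)) (j : Fin (k + 1)) (i : Fin k) :
    (s.remove j).1 i = s.1 ⟨if (i : ℕ) < j then i else i + 1, by split <;> omega⟩ := by
  simp only [MSeq.remove, Fin.succAbove, Fin.lt_def, Fin.val_castSucc]
  refine congrArg s.1 (Fin.ext ?_)
  split_ifs <;> simp

/-- Repeating the entry at position `p` of a multi-sequence. -/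
def MSeq.dup {k : ℕ} (s : MSeq P k) (p : Fin k) : MSeq P (k + 1) :=
  ⟨fun i => s.1 ⟨if (i : ℕ) ≤ p then i else i - 1, by split <;> omega⟩,
    fun i j hij => s.2.1 (by
      simp only [Fin.le_def] at hij ⊢
      split_ifs <;> omega),
    fun _ => s.2.2 _⟩

lemma seqHead_dup {k : ℕ} (s : MSeq P k) (p : Fin k) : seqHead (s.dup p).1 = seqHead s.1 := by
  have hk : 0 < k := Fin.pos p
  simp [seqHead, hk, MSeq.dup]

lemma MSeq.remove_dup_of_lt {k : ℕ} (s : MSeq P (k + 1)) (p j : Fin (k + 1)) (h : j < p)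
    (hk : (p : ℕ) - 1 < k) :
    (s.dup p).remove j.castSucc = (s.remove j).dup ⟨p - 1, hk⟩ := by
  refine MSeq.ext fun i => ?_
  rw [MSeq.remove_apply]
  simp only [MSeq.dup, MSeq.remove_apply, Fin.val_castSucc]
  simp only [Fin.lt_def] at h
  refine congrArg s.1 (Fin.ext ?_)
  simp only []
  split_ifs <;> omega

lemma MSeq.remove_dup_of_gt {k : ℕ} (s : MSeq P (k + 1)) (p j : Fin (k + 1)) (h : p < j)
    (hk : (p : ℕ) < k) :
    (s.dup p).remove j.succ = (s.remove j).dup ⟨p, hk⟩ := by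
  refine MSeq.ext fun i => ?_
  rw [MSeq.remove_apply]
  simp only [MSeq.dup, MSeq.remove_apply, Fin.val_succ]
  simp only [Fin.lt_def] at h
  refine congrArg s.1 (Fin.ext ?_)
  simp only []
  split_ifs <;> omega

lemma MSeq.remove_dup_self {k : ℕ} (s : MSeq P (k + 1)) (p : Fin (k + 1)) :
    (s.dup p).remove p.castSucc = s := by
  refine MSeq.ext fun i => ?_
  rw [MSeq.remove_apply]
  simp only [MSeq.dup, Fin.val_castSucc]
  refine congrArg s.1 (Fin.ext ?_)
  simp only []
  split_ifs <;> omega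

lemma MSeq.remove_dup_succ {k : ℕ} (s : MSeq P (k + 1)) (p : Fin (k + 1)) :
    (s.dup p).remove p.succ = s := by
  refine MSeq.ext fun i => ?_
  rw [MSeq.remove_apply]
  simp only [MSeq.dup, Fin.val_succ]
  refine congrArg s.1 (Fin.ext ?_)
  simp only []
  split_ifs <;> omega

lemma MSeq.remove_succ_eq {k : ℕ} (s : MSeq P (k + 1)) (p : Fin (k + 1))
    (h : (p : ℕ) + 1 < k + 1) (e : s.1 p = s.1 ⟨p + 1, h⟩) :
    s.remove ⟨p + 1, h⟩ = s.remove p := by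
  refine MSeq.ext fun i => ?_
  simp only [MSeq.remove_apply]
  rcases eq_or_ne (i : ℕ) p with hi | hi
  · simpa [hi] using e
  · refine congrArg s.1 (Fin.ext ?_)
    simp only []
    split_ifs <;> omega

lemma MSeq.isFirstRepeat_remove_of_lt {k : ℕ} {s : MSeq P (k + 1)} {p j : Fin (k + 1)}
    (hp : IsFirstRepeat s.1 p) (h : j < p) (hk : (p : ℕ) - 1 < k) :
    IsFirstRepeat (s.remove j).1 ⟨p - 1, hk⟩ := by
  obtain ⟨⟨hlt, e⟩, hinj⟩ := hp
  simp only [Fin.lt_def] at h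
  refine ⟨⟨by simp only []; omega, ?_⟩, fun a b hab hb => ?_⟩
  · simp only [MSeq.remove_apply]
    convert e using 3 <;> split_ifs <;> omega
  · simp only [MSeq.remove_apply]
    simp only [Fin.lt_def, Fin.le_def] at hab hb
    apply hinj <;> simp only [Fin.lt_def, Fin.le_def] <;> split_ifs <;> omega

lemma MSeq.isFirstRepeat_remove_of_gt {k : ℕ} {s : MSeq P (k + 1)} {p j : Fin (k + 1)}
    (hp : IsFirstRepeat s.1 p) (h : (p : ℕ) + 2 ≤ j) (hk : (p : ℕ) < k) :
    IsFirstRepeat (s.remove j).1 ⟨p, hk⟩ := by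
  obtain ⟨⟨hlt, e⟩, hinj⟩ := hp
  refine ⟨⟨by simp only []; omega, ?_⟩, fun a b hab hb => ?_⟩
  · simp only [MSeq.remove_apply]
    convert e using 3 <;> split_ifs <;> omega
  · simp only [MSeq.remove_apply]
    simp only [Fin.lt_def, Fin.le_def] at hab hb
    apply hinj <;> simp only [Fin.lt_def, Fin.le_def] <;> split_ifs <;> omega

lemma MSeq.not_strictMono_remove {k : ℕ} {s : MSeq P (k + 1)} {p j : Fin (k + 1)}
    (hp : IsFirstRepeat s.1 p) (h₀ : (j : ℕ) ≠ p) (h₁ : (j : ℕ) ≠ p + 1) :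
    ¬ StrictMono (s.remove j).1 := by
  obtain ⟨hlt, -⟩ := hp.1
  rcases lt_or_ge j p with h | h
  · exact (isFirstRepeat_remove_of_lt hp h (by omega)).not_strictMono
  · simp only [Fin.le_def] at h
    exact (isFirstRepeat_remove_of_gt hp (by omega) (by omega)).not_strictMono

end Duplication

section Normalization

variable {R : Type} [CommRing R] {P : Type} [PartialOrder P] [OrderTop P] (F : Colouring R P)

/-- The chain `F_x^{t₁}(m) t` of `S_*(P,F)`, for `m ∈ F(x)` and `x ≤ t₁`. -/
def sTerm {k : ℕ} {x : P} (m : F.M x) (t : MSeq P k) (h : x ≤ seqHead t.1) : SMod F k :=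
  DirectSum.lof R (MSeq P k) (fun t => F.M (seqHead t.1)) t (F.map h m)

/-- The chain `F_x^{t₁}(m) t` of `C_*(P,F)`, for `m ∈ F(x)` and `x ≤ t₁`. -/
def cTerm {k : ℕ} {x : P} (m : F.M x) (t : CSeq P k) (h : x ≤ seqHead t.1) : CMod F k :=
  DirectSum.lof R (CSeq P k) (fun t => F.M (seqHead t.1)) t (F.map h m)

variable {F}

lemma lof_eq_sTerm {k : ℕ} (t : MSeq P k) (m : F.M (seqHead t.1)) :
    DirectSum.lof R (MSeq P k) (fun t => F.M (seqHead t.1)) t m = sTerm F m t le_rfl := by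
  rw [sTerm, F.map_id, LinearMap.id_apply]

lemma lof_eq_cTerm {k : ℕ} (t : CSeq P k) (m : F.M (seqHead t.1)) :
    DirectSum.lof R (CSeq P k) (fun t => F.M (seqHead t.1)) t m = cTerm F m t le_rfl := by
  rw [cTerm, F.map_id, LinearMap.id_apply]

lemma sTerm_congr {k : ℕ} {x : P} (m : F.M x) {t t' : MSeq P k} (e : t = t')
    (h : x ≤ seqHead t.1) : sTerm F m t h = sTerm F m t' (e ▸ h) := by
  subst e; rfl

lemma sMod_hom_ext {k : ℕ} {N : Type} [AddCommGroup N] [Module R N] {f g : SMod F k →ₗ[R] N}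
    (h : ∀ (x : P) (m : F.M x) (t : MSeq P k) (hx : x ≤ seqHead t.1),
      f (sTerm F m t hx) = g (sTerm F m t hx)) : f = g := by
  refine DirectSum.linearMap_ext R fun t => LinearMap.ext fun m => ?_
  simpa only [LinearMap.comp_apply, lof_eq_sTerm] using h _ m t le_rfl

lemma cMod_hom_ext {k : ℕ} {N : Type} [AddCommGroup N] [Module R N] {f g : CMod F k →ₗ[R] N}
    (h : ∀ (x : P) (m : F.M x) (t : CSeq P k) (hx : x ≤ seqHead t.1),
      f (cTerm F m t hx) = g (cTerm F m t hx)) : f = g := by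
  refine DirectSum.linearMap_ext R fun t => LinearMap.ext fun m => ?_
  simpa only [LinearMap.comp_apply, lof_eq_cTerm] using h _ m t le_rfl

lemma sDiff_sTerm {k : ℕ} {x : P} (m : F.M x) (t : MSeq P (k + 1)) (h : x ≤ seqHead t.1) :
    sDiff F k (sTerm F m t h) =
      ∑ j : Fin (k + 1), (-1 : R) ^ (j : ℕ) •
        sTerm F m (t.remove j) (h.trans (seqHead_le_msRemove t j)) := by
  simp only [sDiff, sTerm, DirectSum.toModule_lof, LinearMap.sum_apply, LinearMap.smul_apply,
    LinearMap.comp_apply, Colouring.map_map]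

lemma cDiff_cTerm {k : ℕ} {x : P} (m : F.M x) (t : CSeq P (k + 1)) (h : x ≤ seqHead t.1) :
    cDiff F k (cTerm F m t h) =
      ∑ j : Fin (k + 1), (-1 : R) ^ (j : ℕ) •
        cTerm F m (t.remove j) (h.trans (seqHead_le_csRemove t j)) := by
  simp only [cDiff, cTerm, DirectSum.toModule_lof, LinearMap.sum_apply, LinearMap.smul_apply,
    LinearMap.comp_apply, Colouring.map_map]

/-- A strictly increasing sequence, viewed as a multi-sequence. -/
def CSeq.toMSeq {k : ℕ} (t : CSeq P k) : MSeq P k := ⟨t.1, t.2.1.monotone, t.2.2⟩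

/-- A strictly increasing multi-sequence, viewed as a strict sequence. -/
def MSeq.toCSeq {k : ℕ} (t : MSeq P k) (ht : StrictMono t.1) : CSeq P k := ⟨t.1, ht, t.2.2⟩

lemma CSeq.le_seqHead_toMSeq {k : ℕ} {x : P} {t : CSeq P k} (h : x ≤ seqHead t.1) :
    x ≤ seqHead t.toMSeq.1 := h

lemma MSeq.le_seqHead_toCSeq {k : ℕ} {x : P} {t : MSeq P k} (h : x ≤ seqHead t.1)
    (ht : StrictMono t.1) : x ≤ seqHead (t.toCSeq ht).1 := h

lemma MSeq.strictMono_remove {k : ℕ} {t : MSeq P (k + 1)} (ht : StrictMono t.1)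
    (j : Fin (k + 1)) : StrictMono (t.remove j).1 :=
  ht.comp (Fin.strictMono_succAbove j)

lemma cIncl_cTerm {k : ℕ} {x : P} (m : F.M x) (t : CSeq P k) (h : x ≤ seqHead t.1) :
    cIncl F k (cTerm F m t h) = sTerm F m t.toMSeq (CSeq.le_seqHead_toMSeq h) := by
  simp only [cIncl, cTerm, DirectSum.toModule_lof]
  rfl

lemma sDiff_comp_cIncl (F : Colouring R P) (k : ℕ) :
    (sDiff F k).comp (cIncl F (k + 1)) = (cIncl F k).comp (cDiff F k) := by
  refine cMod_hom_ext fun x m t hx => ?_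
  simp only [LinearMap.comp_apply, cIncl_cTerm, sDiff_sTerm, cDiff_cTerm, map_sum, map_smul]
  rfl

variable (F) in
open Classical in
/-- The projection `S_*(P,F) → C_*(P,F)` killing the sequences with repetitions. -/
def cProj (k : ℕ) : SMod F k →ₗ[R] CMod F k :=
  DirectSum.toModule R _ _ fun s =>
    if h : StrictMono s.1 then
      DirectSum.lof R (CSeq P k) (fun t => F.M (seqHead t.1)) ⟨s.1, h, s.2.2⟩
    else 0

lemma cProj_of_strictMono {k : ℕ} {x : P} (m : F.M x) (t : MSeq P k) (h : x ≤ seqHead t.1)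
    (ht : StrictMono t.1) :
    cProj F k (sTerm F m t h) =
      cTerm F m (t.toCSeq ht) (MSeq.le_seqHead_toCSeq h ht) := by
  rw [cProj, sTerm, DirectSum.toModule_lof, dif_pos ht]
  rfl

lemma cProj_of_not_strictMono {k : ℕ} {x : P} (m : F.M x) (t : MSeq P k) (h : x ≤ seqHead t.1)
    (ht : ¬ StrictMono t.1) : cProj F k (sTerm F m t h) = 0 := by
  rw [cProj, sTerm, DirectSum.toModule_lof, dif_neg ht, LinearMap.zero_apply]

lemma cProj_comp_cIncl (F : Colouring R P) (k : ℕ) :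
    (cProj F k).comp (cIncl F k) = LinearMap.id := by
  refine cMod_hom_ext fun x m t hx => ?_
  rw [LinearMap.comp_apply, cIncl_cTerm, cProj_of_strictMono _ _ _ t.2.1]
  rfl

lemma cDiff_comp_cProj (F : Colouring R P) (k : ℕ) :
    (cDiff F k).comp (cProj F (k + 1)) = (cProj F k).comp (sDiff F k) := by
  refine sMod_hom_ext fun x m t hx => ?_
  simp only [LinearMap.comp_apply, sDiff_sTerm, map_sum, map_smul]
  by_cases ht : StrictMono t.1
  · rw [cProj_of_strictMono _ _ _ ht, cDiff_cTerm]
    refine Finset.sum_congr rfl fun j _ => ?_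
    rw [cProj_of_strictMono _ _ _ (MSeq.strictMono_remove ht j)]
    rfl
  · rw [cProj_of_not_strictMono _ _ _ ht, map_zero]
    obtain ⟨p, hp⟩ := exists_isFirstRepeat t.2.1 ht
    obtain ⟨hlt, e⟩ := hp.1
    rw [Fintype.sum_eq_add p ⟨p + 1, hlt⟩ (by simp [Fin.ext_iff])]
    · rw [sTerm_congr m (t.remove_succ_eq p hlt e), ← add_smul, pow_succ]
      simp
    · rintro j ⟨h₀, h₁⟩
      rw [cProj_of_not_strictMono _ _ _ (MSeq.not_strictMono_remove hp
        (fun h => h₀ (Fin.ext h)) (fun h => h₁ (Fin.ext h))), smul_zero]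

variable (F) in
open Classical in
/-- The homotopy on `S_*(P,F)` which duplicates the first repeated entry, with sign. -/
def dupHomotopy (k : ℕ) : SMod F k →ₗ[R] SMod F (k + 1) :=
  DirectSum.toModule R _ _ fun s =>
    if h : ∃ p, IsFirstRepeat s.1 p then
      -((-1 : R) ^ (h.choose : ℕ)) •
        (DirectSum.lof R (MSeq P (k + 1)) (fun t => F.M (seqHead t.1)) (s.dup h.choose)).comp
          (F.map (seqHead_dup s h.choose).ge)
    else 0

lemma dupHomotopy_of_isFirstRepeat {k : ℕ} {x : P} (m : F.M x) (t : MSeq P k)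
    (h : x ≤ seqHead t.1) {p : Fin k} (hp : IsFirstRepeat t.1 p) :
    dupHomotopy F k (sTerm F m t h) =
      -((-1 : R) ^ (p : ℕ)) • sTerm F m (t.dup p) (h.trans (seqHead_dup t p).ge) := by
  have hex : ∃ p, IsFirstRepeat t.1 p := ⟨p, hp⟩
  obtain rfl : hex.choose = p := hex.choose_spec.unique hp
  rw [dupHomotopy, sTerm, DirectSum.toModule_lof, dif_pos hex, LinearMap.smul_apply,
    LinearMap.comp_apply, Colouring.map_map, sTerm]

lemma dupHomotopy_of_strictMono {k : ℕ} {x : P} (m : F.M x) (t : MSeq P k)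
    (h : x ≤ seqHead t.1) (ht : StrictMono t.1) : dupHomotopy F k (sTerm F m t h) = 0 := by
  rw [dupHomotopy, sTerm, DirectSum.toModule_lof,
    dif_neg (fun ⟨_, hp⟩ => hp.not_strictMono ht), LinearMap.zero_apply]

lemma sDiff_dupHomotopy_add_of_isFirstRepeat {k : ℕ} {x : P} (m : F.M x) (t : MSeq P (k + 1))
    (h : x ≤ seqHead t.1) {p : Fin (k + 1)} (hp : IsFirstRepeat t.1 p) :
    sDiff F (k + 1) (dupHomotopy F (k + 1) (sTerm F m t h)) +
      dupHomotopy F k (sDiff F k (sTerm F m t h)) = -sTerm F m t h := by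
  obtain ⟨hlt, e⟩ := hp.1
  rw [dupHomotopy_of_isFirstRepeat m t h hp, map_smul, sDiff_sTerm, sDiff_sTerm,
    Finset.smul_sum, map_sum]
  have hsq : (-1 : R) ^ (p : ℕ) * (-1) ^ (p : ℕ) = 1 := by
    rw [← mul_pow]; simp
  refine sum_add_sum_eq_of_cancel _ _ _ p hlt ?_ ?_ ?_ ?_ ?_ ?_
  · intro j hj
    rw [map_smul, dupHomotopy_of_isFirstRepeat m _ _
      (MSeq.isFirstRepeat_remove_of_lt hp hj (by omega)),
      sTerm_congr m (t.remove_dup_of_lt p j hj (by omega)), smul_smul, smul_smul, ← add_smul]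
    obtain ⟨q, hq⟩ : ∃ q, (p : ℕ) = q + 1 := ⟨p - 1, by omega⟩
    simp only [hq, Fin.val_castSucc, Nat.add_sub_cancel]
    convert zero_smul R _ using 2
    ring
  · have e₀ : (t.dup p).remove ⟨p, by omega⟩ = t := t.remove_dup_self p
    rw [sTerm_congr m e₀, smul_smul, neg_mul, hsq, neg_one_smul]
  · have e₁ : (t.dup p).remove ⟨p + 1, by omega⟩ = t := t.remove_dup_succ p
    rw [sTerm_congr m e₁, smul_smul, pow_succ, ← mul_assoc, neg_mul, hsq]
    simp
  · have e₂ : (t.dup p).remove ⟨p + 2, by omega⟩ = t := by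
      have := t.remove_dup_of_gt p ⟨p + 1, hlt⟩ (by simp [Fin.lt_def]) (by omega)
      refine this.trans ?_
      rw [t.remove_succ_eq p hlt e]
      refine MSeq.ext fun i => ?_
      simp only [MSeq.dup, MSeq.remove_apply]
      rcases eq_or_ne (i : ℕ) p with hi | hi
      · obtain rfl : i = p := Fin.ext hi
        simpa using e.symm
      · refine congrArg t.1 (Fin.ext ?_)
        simp only []
        split_ifs <;> omega
    rw [sTerm_congr m e₂, smul_smul, pow_add, ← mul_assoc, neg_mul, hsq]
    simp
  · rw [sTerm_congr m (t.remove_succ_eq p hlt e), ← map_add, ← add_smul, pow_succ]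
    simp
  · intro j hj
    rw [map_smul, dupHomotopy_of_isFirstRepeat m _ _
      (MSeq.isFirstRepeat_remove_of_gt hp hj (by omega)),
      sTerm_congr m (t.remove_dup_of_gt p j (by simp only [Fin.lt_def]; omega) (by omega)),
      smul_smul, smul_smul, ← add_smul]
    simp only [Fin.val_succ]
    convert zero_smul R _ using 2
    ring

lemma cIncl_cProj_of_strictMono {k : ℕ} {x : P} (m : F.M x) (t : MSeq P k)
    (h : x ≤ seqHead t.1) (ht : StrictMono t.1) :
    cIncl F k (cProj F k (sTerm F m t h)) = sTerm F m t h := by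
  rw [cProj_of_strictMono _ _ _ ht, cIncl_cTerm]
  rfl

lemma cIncl_comp_cProj_sub_id (F : Colouring R P) (k : ℕ) :
    (cIncl F (k + 1)).comp (cProj F (k + 1)) - LinearMap.id =
      (sDiff F (k + 1)).comp (dupHomotopy F (k + 1)) + (dupHomotopy F k).comp (sDiff F k) := by
  refine sMod_hom_ext fun x m t hx => ?_
  simp only [LinearMap.sub_apply, LinearMap.add_apply, LinearMap.comp_apply, LinearMap.id_apply]
  by_cases ht : StrictMono t.1
  · rw [cIncl_cProj_of_strictMono _ _ _ ht, dupHomotopy_of_strictMono _ _ _ ht, sub_self, map_zero,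
      zero_add, sDiff_sTerm, map_sum]
    refine (Finset.sum_eq_zero fun j _ => ?_).symm
    rw [map_smul, dupHomotopy_of_strictMono _ _ _ (MSeq.strictMono_remove ht j),
      smul_zero]
  · obtain ⟨p, hp⟩ := exists_isFirstRepeat t.2.1 ht
    rw [sDiff_dupHomotopy_add_of_isFirstRepeat m t hx hp, cProj_of_not_strictMono _ _ _ ht,
      map_zero, zero_sub]

lemma cIncl_comp_cProj_sub_id_zero (F : Colouring R P) :
    (cIncl F 0).comp (cProj F 0) - LinearMap.id = (sDiff F 0).comp (dupHomotopy F 0) := by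
  refine sMod_hom_ext fun x m t hx => ?_
  have ht : StrictMono t.1 := Subsingleton.strictMono _
  simp only [LinearMap.sub_apply, LinearMap.comp_apply, LinearMap.id_apply]
  rw [cIncl_cProj_of_strictMono _ _ _ ht, dupHomotopy_of_strictMono _ _ _ ht, sub_self, map_zero]

end Normalization

section HomologyEquiv

variable {R : Type} [CommRing R] {X Y : ℕ → Type}
  [∀ n, AddCommGroup (X n)] [∀ n, Module R (X n)] [∀ n, AddCommGroup (Y n)] [∀ n, Module R (Y n)]
  {dX : ∀ n, X (n + 1) →ₗ[R] X n} {dY : ∀ n, Y (n + 1) →ₗ[R] Y n}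

lemma inducedHom_comp_eq_id {f : ∀ n, X n →ₗ[R] Y n} {g : ∀ n, Y n →ₗ[R] X n}
    (hf : ∀ n, (dY n).comp (f (n + 1)) = (f n).comp (dX n))
    (hg : ∀ n, (dX n).comp (g (n + 1)) = (g n).comp (dY n))
    (H : ∀ n, X n →ₗ[R] X (n + 1))
    (hsucc : ∀ n, (g (n + 1)).comp (f (n + 1)) - LinearMap.id =
      (dX (n + 1)).comp (H (n + 1)) + (H n).comp (dX n))
    (hzero : (g 0).comp (f 0) - LinearMap.id = (dX 0).comp (H 0)) (n : ℕ) :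
    (inducedHom dY dX g hg n).comp (inducedHom dX dY f hf n) = LinearMap.id := by
  refine LinearMap.ext fun z => ?_
  obtain ⟨⟨z, hz⟩, rfl⟩ := Submodule.Quotient.mk_surjective _ z
  refine (Submodule.Quotient.eq _).2 ⟨H n z, ?_⟩
  change dX n (H n z) = g n (f n z) - z
  cases n with
  | zero => exact (LinearMap.congr_fun hzero z).symm
  | succ n =>
    have hz' : dX n z = 0 := hz
    simpa [hz'] using (LinearMap.congr_fun (hsucc n) z).symm

lemma IsChainHomotopyEquivalence.nonempty_hHomology_equiv {f : ∀ n, X n →ₗ[R] Y n}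
    (h : IsChainHomotopyEquivalence dX dY f)
    (hf : ∀ n, (dY n).comp (f (n + 1)) = (f n).comp (dX n)) (n : ℕ) :
    Nonempty (hHomology dY n ≃ₗ[R] hHomology dX n) := by
  obtain ⟨g, H, K, hg, hH, hH₀, hK, hK₀⟩ := h
  exact ⟨LinearEquiv.ofLinearMap (inducedHom dY dX g hg n) (inducedHom dX dY f hf n)
    (inducedHom_comp_eq_id hf hg H hH hH₀ n) (inducedHom_comp_eq_id hg hf K hK hK₀ n)⟩

end HomologyEquiv

/-- **Statement 5.** For any coloured poset `(P,F)`, the inclusion `C_*(P,F) → S_*(P,F)` is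
a chain homotopy equivalence; in particular `H_n(P,F) ≅ H_n(C_*(P,F))` for all `n`. -/
theorem cIncl_homotopyEquivalence {R : Type} [CommRing R] {P : Type}
    [PartialOrder P] [OrderTop P] (F : Colouring R P) :
    (∀ k : ℕ, (sDiff F k).comp (cIncl F (k+1)) = (cIncl F k).comp (cDiff F k)) ∧
    IsChainHomotopyEquivalence (cDiff F) (sDiff F) (cIncl F) ∧
    (∀ n : ℕ, Nonempty (hHomology (sDiff F) n ≃ₗ[R] hHomology (cDiff F) n)) := by
  have heq : IsChainHomotopyEquivalence (cDiff F) (sDiff F) (cIncl F) :=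
    ⟨cProj F, fun _ => 0, dupHomotopy F, cDiff_comp_cProj F,
      fun n => by simp [cProj_comp_cIncl], by simp [cProj_comp_cIncl],
      cIncl_comp_cProj_sub_id F, cIncl_comp_cProj_sub_id_zero F⟩
  exact ⟨sDiff_comp_cIncl F, heq, heq.nonempty_hHomology_equiv (sDiff_comp_cIncl F)⟩
end
end

section
/- Let P be a poset with a unique maximal element 1_P and a minimal element 0_P with 0_P ≠ 1_P, and let F be the constant colouring by an R-module A (i.e. F(x) = A for all x and F_x^y = id_A for all x ≤ y). Then the complex C_*(P,F) is acyclic, i.e. H_n(P,F) = 0 for all n. -/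
open DirectSum

noncomputable section

section Cone

variable {R : Type} [CommRing R] {P : Type} [PartialOrder P] [OrderTop P]

lemma CSeq.seqHead_le {k : ℕ} (s : CSeq P k) (i : Fin k) : seqHead s.1 ≤ s.1 i := by
  have hk : 0 < k := i.pos
  rw [seqHead, dif_pos hk]
  exact s.2.1.monotone (Nat.zero_le _)

lemma seqHead_succ {k : ℕ} (s : Fin (k + 1) → P) : seqHead s = s 0 :=
  dif_pos k.succ_pos

lemma CSeq.seqHead_remove_succ {k : ℕ} (s : CSeq P (k + 1)) (j : Fin k) :
    seqHead (s.remove j.succ).1 = seqHead s.1 := by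
  cases k with
  | zero => exact j.elim0
  | succ k => simp [seqHead_succ, CSeq.remove]

variable (A : Type) [AddCommGroup A] [Module R A]

/-- The inclusion of the summand indexed by `s` in the chains of a constant colouring. -/
def constChain {k : ℕ} (s : CSeq P k) : A →ₗ[R] CMod (constColouring R P A) k :=
  DirectSum.lof R (CSeq P k) (fun t => (constColouring R P A).M (seqHead t.1)) s

lemma constChain_hom_ext {k : ℕ} {N : Type} [AddCommGroup N] [Module R N]
    {f g : CMod (constColouring R P A) k →ₗ[R] N}
    (h : ∀ s a, f (constChain A s a) = g (constChain A s a)) : f = g :=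
  DirectSum.linearMap_ext R fun s => LinearMap.ext (h s)

lemma toModule_constChain {k : ℕ} {N : Type} [AddCommGroup N] [Module R N]
    (φ : ∀ s : CSeq P k, (constColouring R P A).M (seqHead s.1) →ₗ[R] N) (s : CSeq P k) (a : A) :
    DirectSum.toModule R (CSeq P k) N φ (constChain A s a) = φ s a :=
  DirectSum.toModule_lof (φ := φ) R s a

lemma cDiff_constChain {k : ℕ} (s : CSeq P (k + 1)) (a : A) :
    cDiff (constColouring R P A) k (constChain A s a) =
      ∑ j : Fin (k + 1), ((-1 : R) ^ (j : ℕ)) • constChain A (s.remove j) a :=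
  (toModule_constChain A _ s a).trans (LinearMap.sum_apply Finset.univ _ a)

variable [OrderBot P]

/-- Prepending `⊥` to a sequence that does not start at `⊥`. -/
def CSeq.consBot (hP : (⊥ : P) ≠ ⊤) {k : ℕ} (s : CSeq P k) (hs : seqHead s.1 ≠ ⊥) :
    CSeq P (k + 1) :=
  ⟨Fin.cons ⊥ s.1, by
    constructor
    · intro i j hij
      induction j using Fin.cases with
      | zero => exact absurd hij (Fin.not_lt_zero i)
      | succ j =>
        induction i using Fin.cases with
        | zero => simpa using (bot_lt_iff_ne_bot.2 hs).trans_le (s.seqHead_le j)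
        | succ i => simpa using s.2.1 (Fin.succ_lt_succ_iff.1 hij)
    · intro i
      induction i using Fin.cases with
      | zero => simpa using hP
      | succ i => simpa using s.2.2 i⟩

lemma CSeq.consBot_remove_zero (hP : (⊥ : P) ≠ ⊤) {k : ℕ} (s : CSeq P k)
    (hs : seqHead s.1 ≠ ⊥) : (s.consBot hP hs).remove 0 = s :=
  Subtype.ext <| funext fun i => by simp [CSeq.remove, CSeq.consBot]

lemma CSeq.seqHead_remove_ne_bot {k : ℕ} (s : CSeq P (k + 1)) (hs : seqHead s.1 ≠ ⊥)
    (j : Fin (k + 1)) : seqHead (s.remove j).1 ≠ ⊥ := fun h =>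
  hs (le_bot_iff.1 ((seqHead_le_csRemove s j).trans h.le))

lemma CSeq.consBot_remove_succ (hP : (⊥ : P) ≠ ⊤) {k : ℕ} (s : CSeq P (k + 1))
    (hs : seqHead s.1 ≠ ⊥) (j : Fin (k + 1)) :
    (s.consBot hP hs).remove j.succ =
      (s.remove j).consBot hP (s.seqHead_remove_ne_bot hs j) :=
  Subtype.ext <| funext fun i => by
    induction i using Fin.cases <;> simp [CSeq.remove, CSeq.consBot]

lemma CSeq.seqHead_remove_zero_ne_bot (hP : (⊥ : P) ≠ ⊤) {k : ℕ} (s : CSeq P (k + 1)) :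
    seqHead (s.remove 0).1 ≠ ⊥ := by
  cases k with
  | zero => simpa [seqHead] using hP.symm
  | succ k =>
    rw [seqHead_succ]
    exact (bot_le.trans_lt (s.2.1 (Fin.succ_pos 0))).ne'

lemma CSeq.consBot_remove_zero_self (hP : (⊥ : P) ≠ ⊤) {k : ℕ} (s : CSeq P (k + 1))
    (hs : seqHead s.1 = ⊥) :
    (s.remove 0).consBot hP (s.seqHead_remove_zero_ne_bot hP) = s :=
  Subtype.ext <| funext fun i => by
    rw [seqHead_succ] at hs
    induction i using Fin.cases <;> simp [CSeq.remove, CSeq.consBot, hs]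

/-- The contracting homotopy of the chains of a constant colouring: prepend `⊥` to sequences
not starting at `⊥`, and kill the others. -/
def botHomotopy (hP : (⊥ : P) ≠ ⊤) (k : ℕ) :
    CMod (constColouring R P A) k →ₗ[R] CMod (constColouring R P A) (k + 1) :=
  DirectSum.toModule R _ _ fun s =>
    if hs : seqHead s.1 = ⊥ then 0 else constChain A (s.consBot hP hs)

lemma botHomotopy_of_eq_bot (hP : (⊥ : P) ≠ ⊤) {k : ℕ} (s : CSeq P k)
    (hs : seqHead s.1 = ⊥) (a : A) :
    botHomotopy (R := R) A hP k (constChain A s a) = 0 :=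
  (toModule_constChain A _ s a).trans (LinearMap.congr_fun (dif_pos hs) a)

lemma botHomotopy_of_ne_bot (hP : (⊥ : P) ≠ ⊤) {k : ℕ} (s : CSeq P k)
    (hs : seqHead s.1 ≠ ⊥) (a : A) :
    botHomotopy (R := R) A hP k (constChain A s a) = constChain A (s.consBot hP hs) a :=
  (toModule_constChain A _ s a).trans (LinearMap.congr_fun (dif_neg hs) a)

lemma cDiff_comp_botHomotopy_zero (hP : (⊥ : P) ≠ ⊤) :
    (cDiff (constColouring R P A) 0).comp (botHomotopy A hP 0) = LinearMap.id := by
  refine constChain_hom_ext A fun s a => ?_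
  have hs : seqHead s.1 ≠ ⊥ := by simpa [seqHead] using hP.symm
  rw [LinearMap.comp_apply, botHomotopy_of_ne_bot A hP s hs, cDiff_constChain]
  simp [CSeq.consBot_remove_zero]

lemma cDiff_comp_botHomotopy_add (hP : (⊥ : P) ≠ ⊤) (k : ℕ) :
    (cDiff (constColouring R P A) (k + 1)).comp (botHomotopy A hP (k + 1)) +
      (botHomotopy A hP k).comp (cDiff (constColouring R P A) k) = LinearMap.id := by
  refine constChain_hom_ext A fun s a => ?_
  rw [LinearMap.add_apply, LinearMap.comp_apply, LinearMap.comp_apply, cDiff_constChain,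
    map_sum, LinearMap.id_apply]
  simp only [map_smul]
  by_cases hs : seqHead s.1 = ⊥
  · rw [botHomotopy_of_eq_bot A hP s hs, map_zero, zero_add, Fin.sum_univ_succ,
      botHomotopy_of_ne_bot A hP _ (s.seqHead_remove_zero_ne_bot hP),
      s.consBot_remove_zero_self hP hs, Finset.sum_eq_zero]
    · simp
    · intro j _
      rw [botHomotopy_of_eq_bot A hP _ ((s.seqHead_remove_succ j).trans hs), smul_zero]
  · rw [botHomotopy_of_ne_bot A hP s hs, cDiff_constChain, Fin.sum_univ_succ,
      s.consBot_remove_zero hP hs, add_assoc, ← Finset.sum_add_distrib, Finset.sum_eq_zero]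
    · simp
    · intro j _
      rw [s.consBot_remove_succ hP hs,
        botHomotopy_of_ne_bot A hP _ (s.seqHead_remove_ne_bot hs j), Fin.val_succ, pow_succ]
      simp

end Cone

/-- **Statement 7.** Let `P` be a poset with a unique maximal element `1_P` and a minimal
element `0_P ≠ 1_P`, and let `F` be the constant colouring by an `R`-module `A`. Then the
complex `C_*(P,F)` is acyclic, i.e. `H_n(P,F) = 0` for all `n`. -/
theorem constColouring_acyclic {R : Type} [CommRing R] {P : Type}
    [PartialOrder P] [OrderTop P] [OrderBot P] (hP : (⊥ : P) ≠ ⊤)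
    (A : Type) [AddCommGroup A] [Module R A] :
    ∀ n : ℕ, Subsingleton (hHomology (cDiff (constColouring R P A)) n) := by
  intro n
  refine Submodule.Quotient.subsingleton_iff.2 (eq_top_iff.2 ?_)
  rintro ⟨z, hz⟩ -
  refine ⟨botHomotopy A hP n z, ?_⟩
  cases n with
  | zero => exact LinearMap.congr_fun (cDiff_comp_botHomotopy_zero A hP) z
  | succ n =>
    have h := LinearMap.congr_fun (cDiff_comp_botHomotopy_add A hP n) z
    have hz' : cDiff (constColouring R P A) n z = 0 := hz
    rwa [LinearMap.add_apply, LinearMap.comp_apply, LinearMap.comp_apply, hz', map_zero,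
      add_zero] at h
end
end
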